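/- Assume p = 2 and let s ≥ 1 be an integer. Then fil'_2 W_s(K) = fil'_1 W_s(K) + V^{s-1}(fil'_2 K); consequently the (s−1)-fold Verschiebung V^{s-1} : K → W_s(K) carries fil'_2 K into fil'_2 W_s(K) and fil'_1 K into fil'_1 W_s(K), and induces an isomorphism of abelian groups fil'_2 K/fil'_1 K ≅ fil'_2 W_s(K)/fil'_1 W_s(K). (Here fil'_2 K = fil_2 K and fil'_1 K = fil_0 K = 𝒪_K.) -/

import Mathlib

/-!
Setting: `K` is a (complete) discrete valuation field of characteristic `p > 0`, with
normalized additive valuation `v = ord_K : K → ℤ ∪ {∞}` (normalization is expressed by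
the existence of a uniformizer `π` with `v π = 1`).

`W_s(K)` is the ring of `p`-typical Witt vectors of length `s` over `K`.  Following the
paper, a Witt vector is written `a = (a_{s-1}, …, a_0)`, where the paper's component
`a_i` is the component of standard index `s - 1 - i` (so `a_{s-1}` is the leading
component and the Verschiebung `V` sends `(a_{s-1}, …, a_0)` to `(0, a_{s-1}, …, a_0)`,
i.e. it is the standard index shift).  We realize `W_s(K)` as `TruncatedWittVector p s K`.
-/

noncomputable section

open TruncatedWittVector

variable (p : ℕ) [Fact p.Prime] (K : Type*) [Field K] [CharP K p]
variable (v : AddValuation K (WithTop ℤ))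

/-- The Frobenius `F : W_s(K) → W_s(K)`, raising each component to the `p`-th power. -/
def frobW {s : ℕ} (a : TruncatedWittVector p s K) : TruncatedWittVector p s K :=
  TruncatedWittVector.mk p fun i => a.coeff i ^ p

/-- The `k`-fold Verschiebung `V^k : W_t(K) → W_s(K)` (for `t + k = s`), shifting
components: in the paper's notation it sends `(a_{t-1}, …, a_0)` to
`(0, …, 0, a_{t-1}, …, a_0)`. -/
def VShift (k : ℕ) {t : ℕ} (s : ℕ) (a : TruncatedWittVector p t K) :
    TruncatedWittVector p s K :=
  TruncatedWittVector.mk p fun i =>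
    if h : k ≤ (i : ℕ) ∧ (i : ℕ) - k < t then a.coeff ⟨(i : ℕ) - k, h.2⟩ else 0

/-- The truncation `pr_t : W_s(K) → W_t(K)`, `(a_{s-1}, …, a_0) ↦ (a_{s-1}, …, a_{s-t})`. -/
def prW {s : ℕ} (t : ℕ) (ht : t ≤ s) (a : TruncatedWittVector p s K) :
    TruncatedWittVector p t K :=
  TruncatedWittVector.mk p fun i => a.coeff (Fin.castLE ht i)

/-- `ord_K(a) = min_{0 ≤ i ≤ s-1} p^i · ord_K(a_i)` for a Witt vector
`a = (a_{s-1}, …, a_0) ∈ W_s(K)` (the paper's component `a_i` has standard index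
`s - 1 - i`, whence the weight `p ^ (s - 1 - i)` below). -/
def wittOrd {s : ℕ} (a : TruncatedWittVector p s K) : WithTop ℤ :=
  Finset.univ.inf fun i : Fin s => p ^ (s - 1 - (i : ℕ)) • v (a.coeff i)

/-- Brylinski--Kato filtration `fil_n W_s(K) = {a ∈ W_s(K) | ord_K(a) ≥ -n}`. -/
def filW (s : ℕ) (n : ℤ) : Set (TruncatedWittVector p s K) :=
  {a | ((-n : ℤ) : WithTop ℤ) ≤ wittOrd p K v a}

/-- `fil^{(r)}_n W_s(K) = fil_{[n/p^r]} W_s(K)` (for `n ≥ 0`). -/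
def filWr (s r : ℕ) (n : ℕ) : Set (TruncatedWittVector p s K) :=
  filW p K v s ((n / p ^ r : ℕ) : ℤ)

/-- Matsuda's filtration
`fil'_m W_s(K) = fil_{m-1} W_s(K) + V^{s-s'}(fil_m W_{s'}(K))`, `s' = min(ord_p m, s)`. -/
def filW' (s m : ℕ) : Set (TruncatedWittVector p s K) :=
  {a | ∃ b ∈ filW p K v s ((m : ℤ) - 1),
      ∃ c ∈ filW p K v (min (padicValNat p m) s) (m : ℤ),
        a = b + VShift p K (s - min (padicValNat p m) s) s c}

/-- `fil'^{(r)}_m W_s(K) = fil^{(r)}_{m-1} W_s(K) + V^{s-s''}(fil^{(r)}_m W_{s''}(K))`,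
where `s'' = max(0, min(ord_p m, s + r) - r)`. -/
def filW'r (s r m : ℕ) : Set (TruncatedWittVector p s K) :=
  {a | ∃ b ∈ filWr p K v s r (m - 1),
      ∃ c ∈ filWr p K v (min (padicValNat p m) (s + r) - r) r m,
        a = b + VShift p K (s - (min (padicValNat p m) (s + r) - r)) s c}

/-- `fil''^{(r)}_m W_s(K) = fil^{(r)}_{[(m-1)/p]} W_s(K) + V^{s-s''}(fil^{(r)}_{[m/p]} W_{s''}(K))`,
where `s'' = max(0, min(ord_p m, s + r) - r)`. -/
def filW''r (s r m : ℕ) : Set (TruncatedWittVector p s K) :=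
  {a | ∃ b ∈ filWr p K v s r ((m - 1) / p),
      ∃ c ∈ filWr p K v (min (padicValNat p m) (s + r) - r) r (m / p),
        a = b + VShift p K (s - (min (padicValNat p m) (s + r) - r)) s c}

/-- `fil''_m W_s(K) = fil''^{(0)}_m W_s(K)
  = fil_{[(m-1)/p]} W_s(K) + V^{s-s'}(fil_{[m/p]} W_{s'}(K))`. -/
def filW'' (s m : ℕ) : Set (TruncatedWittVector p s K) :=
  filW''r p K v s 0 m

section

variable {p K}

omit [CharP K p]

theorem VShift_truncate (k t : ℕ) (x : WittVector p K) :
    VShift p K k (k + t) (WittVector.truncate t x) =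
      WittVector.truncate (k + t) (WittVector.verschiebung^[k] x) := by
  ext i
  rw [VShift, coeff_mk, WittVector.coeff_truncate]
  split_ifs with h
  · rw [WittVector.coeff_truncate]
    obtain ⟨j, hj⟩ := Nat.exists_eq_add_of_le' h.1
    simp only [hj, Nat.add_sub_cancel, WittVector.iterate_verschiebung_coeff]
  · exact (WittVector.iterate_verschiebung_coeff_eq_zero x (by omega)).symm

theorem VShift_add (k t : ℕ) (a b : TruncatedWittVector p t K) :
    VShift p K k (k + t) (a + b) = VShift p K k (k + t) a + VShift p K k (k + t) b := by
  obtain ⟨x, rfl⟩ := WittVector.truncate_surjective p t K a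
  obtain ⟨y, rfl⟩ := WittVector.truncate_surjective p t K b
  rw [← map_add, VShift_truncate, VShift_truncate, VShift_truncate, ← map_add,
    iterate_map_add]

theorem VShift_sub (k t : ℕ) (a b : TruncatedWittVector p t K) :
    VShift p K k (k + t) (a - b) = VShift p K k (k + t) a - VShift p K k (k + t) b :=
  eq_sub_of_add_eq (by rw [← VShift_add, sub_add_cancel])

theorem VShift_of_isEmpty (k s : ℕ) (a : TruncatedWittVector p 0 K) :
    VShift p K k s a = 0 := by
  ext i
  simp [VShift]

omit [Fact p.Prime] in
theorem VShift_zero_left (s : ℕ) (a : TruncatedWittVector p s K) :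
    VShift p K 0 s a = a := by
  ext i
  simp [VShift]

omit [Fact p.Prime] in
theorem coeff_VShift_last (n : ℕ) (a : TruncatedWittVector p 1 K) :
    (VShift p K n (n + 1) a).coeff (Fin.last n) = a.coeff 0 := by
  simp [VShift]

/-- A truncated Witt vector is the sum of the vector with its last component cleared and
the shift of its last component. -/
theorem clear_last_add_VShift (n : ℕ) (a : TruncatedWittVector p (n + 1) K) :
    mk p (fun i => if (i : ℕ) < n then a.coeff i else 0) +
      VShift p K n (n + 1) (mk p fun _ : Fin 1 => a.coeff (Fin.last n)) = a := by
  obtain ⟨x, rfl⟩ := WittVector.truncate_surjective p (n + 1) K a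
  conv_rhs => rw [← WittVector.init_add_tail x n, map_add]
  congr 1
  · ext i
    simp [WittVector.init, WittVector.select, WittVector.coeff_truncate]
  · ext i
    rcases i.is_le.lt_or_eq with h | h
    · simp [VShift, WittVector.tail, WittVector.select, WittVector.coeff_truncate, h.not_ge]
    · simp [VShift, WittVector.tail, WittVector.select, WittVector.coeff_truncate, h]

theorem coeff_zero_add (a b : TruncatedWittVector p 1 K) :
    (a + b).coeff 0 = a.coeff 0 + b.coeff 0 := by
  obtain ⟨x, rfl⟩ := WittVector.truncate_surjective p 1 K a
  obtain ⟨y, rfl⟩ := WittVector.truncate_surjective p 1 K b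
  rw [← map_add]
  simp only [WittVector.coeff_truncate]
  exact WittVector.add_coeff_zero x y

theorem WithTop.neg_le_nsmul_iff_nonneg {m : ℕ} {k : ℤ} (hk : 0 ≤ k) (hkm : k < m)
    (x : WithTop ℤ) : ((-k : ℤ) : WithTop ℤ) ≤ m • x ↔ 0 ≤ x := by
  constructor
  · intro h
    induction x with
    | top => exact le_top
    | coe z =>
      rw [← WithTop.coe_nsmul, WithTop.coe_le_coe, nsmul_eq_mul] at h
      rw [← WithTop.coe_zero, WithTop.coe_le_coe]
      nlinarith
  · intro h
    have h0 : ((-k : ℤ) : WithTop ℤ) ≤ 0 := by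
      rw [← WithTop.coe_zero, WithTop.coe_le_coe]
      omega
    exact h0.trans (nsmul_nonneg h m)

variable {v}

omit [Fact p.Prime] in
theorem mem_filW {s : ℕ} {n : ℤ} {a : TruncatedWittVector p s K} :
    a ∈ filW p K v s n ↔
      ∀ i : Fin s, ((-n : ℤ) : WithTop ℤ) ≤ p ^ (s - 1 - (i : ℕ)) • v (a.coeff i) := by
  simp [filW, wittOrd, Finset.le_inf_iff]

theorem mem_filW_zero {s : ℕ} {a : TruncatedWittVector p s K} :
    a ∈ filW p K v s 0 ↔ ∀ i : Fin s, 0 ≤ v (a.coeff i) := by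
  rw [mem_filW]
  refine forall_congr' fun i => WithTop.neg_le_nsmul_iff_nonneg le_rfl ?_ _
  exact_mod_cast pow_pos (Fact.out : p.Prime).pos _

omit [Fact p.Prime] in
theorem mem_filW_one_left {n : ℤ} {a : TruncatedWittVector p 1 K} :
    a ∈ filW p K v 1 n ↔ ((-n : ℤ) : WithTop ℤ) ≤ v (a.coeff 0) := by
  simp [mem_filW]

omit [Fact p.Prime] in
theorem filW_mono {s : ℕ} {m n : ℤ} (h : m ≤ n) : filW p K v s m ⊆ filW p K v s n :=
  fun _ ha => le_trans (WithTop.coe_le_coe.2 (neg_le_neg h)) ha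

theorem add_mem_filW_one_left {n : ℤ} {a b : TruncatedWittVector p 1 K}
    (ha : a ∈ filW p K v 1 n) (hb : b ∈ filW p K v 1 n) : a + b ∈ filW p K v 1 n := by
  rw [mem_filW_one_left] at *
  rw [coeff_zero_add]
  exact v.map_le_add ha hb

theorem mem_filW' {s m t : ℕ} (ht : min (padicValNat p m) s = t)
    {a : TruncatedWittVector p s K} :
    a ∈ filW' p K v s m ↔ ∃ b ∈ filW p K v s ((m : ℤ) - 1), ∃ c ∈ filW p K v t (m : ℤ),
      a = b + VShift p K (s - t) s c := by
  subst ht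
  rfl

theorem filW'_one (s : ℕ) : filW' p K v s 1 = filW p K v s 0 := by
  ext a
  rw [mem_filW' (t := 0) (by simp)]
  simp only [VShift_of_isEmpty, add_zero, Nat.cast_one, sub_self]
  refine ⟨?_, fun h => ⟨a, h, 0, ?_, rfl⟩⟩
  · rintro ⟨b, hb, -, -, rfl⟩
    exact hb
  · exact mem_filW.2 fun i => i.elim0

/-- In `fil_{p-1} W_{n+1}(K)` only the last component can fail to be integral. -/
theorem exists_eq_add_VShift_of_mem_filW {n : ℕ} {a : TruncatedWittVector p (n + 1) K}
    (ha : a ∈ filW p K v (n + 1) ((p : ℤ) - 1)) :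
    ∃ b ∈ filW p K v (n + 1) 0, ∃ c ∈ filW p K v 1 ((p : ℤ) - 1),
      a = b + VShift p K n (n + 1) c := by
  have hp : p.Prime := Fact.out
  rw [mem_filW] at ha
  refine ⟨_, ?_, _, ?_, (clear_last_add_VShift n a).symm⟩
  · refine mem_filW_zero.2 fun i => ?_
    rw [coeff_mk]
    split_ifs with h
    · have hk : (p : ℤ) - 1 < (p ^ (n + 1 - 1 - (i : ℕ)) : ℕ) := by
        have := Nat.le_self_pow (n := n + 1 - 1 - (i : ℕ)) (by omega) p
        omega
      exact (WithTop.neg_le_nsmul_iff_nonneg (by have := hp.pos; omega) hk _).1 (ha i)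
    · simp
  · rw [mem_filW_one_left, coeff_mk]
    simpa using ha (Fin.last n)

theorem mem_filW'_prime {n : ℕ} {a : TruncatedWittVector p (n + 1) K} :
    a ∈ filW' p K v (n + 1) p ↔
      ∃ b ∈ filW p K v (n + 1) 0, ∃ c ∈ filW p K v 1 p, a = b + VShift p K n (n + 1) c := by
  have hp : p.Prime := Fact.out
  rw [mem_filW' (t := 1) (by rw [padicValNat_self]; omega), Nat.add_sub_cancel]
  constructor
  · rintro ⟨b, hb, c, hc, rfl⟩
    obtain ⟨b', hb', d, hd, rfl⟩ := exists_eq_add_VShift_of_mem_filW hb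
    refine ⟨b', hb', d + c, add_mem_filW_one_left (filW_mono (by omega) hd) hc, ?_⟩
    rw [VShift_add, add_assoc]
  · rintro ⟨b, hb, c, hc, rfl⟩
    exact ⟨b, filW_mono (by have := hp.pos; omega) hb, c, hc, rfl⟩

theorem filW'_one_left_prime : filW' p K v 1 p = filW p K v 1 p := by
  ext a
  rw [mem_filW'_prime (n := 0)]
  simp only [VShift_zero_left]
  constructor
  · rintro ⟨b, hb, c, hc, rfl⟩
    exact add_mem_filW_one_left (filW_mono (by omega) hb) hc
  · exact fun ha => ⟨0, mem_filW_zero.2 fun i => by simp, a, ha, (zero_add a).symm⟩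

theorem VShift_mem_filW_zero {k s t : ℕ} {a : TruncatedWittVector p t K}
    (ha : a ∈ filW p K v t 0) : VShift p K k s a ∈ filW p K v s 0 := by
  rw [mem_filW_zero] at *
  intro i
  rw [VShift, coeff_mk]
  split_ifs with h
  · exact ha _
  · simp

end

/-- Lemma 1.14 of the paper.  Assume `p = 2` and `s ≥ 1`.  Then
`fil'_2 W_s(K) = fil'_1 W_s(K) + V^{s-1}(fil'_2 K)`; consequently `V^{s-1} : K → W_s(K)`
carries `fil'_2 K` into `fil'_2 W_s(K)` and `fil'_1 K` into `fil'_1 W_s(K)`, is additive,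
and induces an isomorphism of abelian groups
`fil'_2 K/fil'_1 K ≅ fil'_2 W_s(K)/fil'_1 W_s(K)` (expressed below by additivity,
injectivity and surjectivity of the induced map). -/
theorem statement4 (hp2 : p = 2) (hv : ∃ π : K, v π = 1) (s : ℕ) (hs : 1 ≤ s) :
    (filW' p K v s 2 =
      {x | ∃ b ∈ filW' p K v s 1, ∃ c ∈ filW' p K v 1 2,
        x = b + VShift p K (s - 1) s c}) ∧
    (∀ c ∈ filW' p K v 1 2, VShift p K (s - 1) s c ∈ filW' p K v s 2) ∧
    (∀ c ∈ filW' p K v 1 1, VShift p K (s - 1) s c ∈ filW' p K v s 1) ∧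
    (∀ a b : TruncatedWittVector p 1 K,
        VShift p K (s - 1) s (a + b) = VShift p K (s - 1) s a + VShift p K (s - 1) s b) ∧
    (∀ a ∈ filW' p K v 1 2, ∀ b ∈ filW' p K v 1 2,
        VShift p K (s - 1) s a - VShift p K (s - 1) s b ∈ filW' p K v s 1 →
        a - b ∈ filW' p K v 1 1) ∧
    (∀ x ∈ filW' p K v s 2, ∃ a ∈ filW' p K v 1 2,
        x - VShift p K (s - 1) s a ∈ filW' p K v s 1) := by
  obtain ⟨n, rfl⟩ := Nat.exists_eq_add_of_le' hs
  subst hp2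
  have hmem {x : TruncatedWittVector 2 (n + 1) K} := mem_filW'_prime (v := v) (a := x)
  simp only [Nat.add_sub_cancel, filW'_one, filW'_one_left_prime]
  refine ⟨Set.ext fun x => hmem, fun c hc => ?_, fun c hc => VShift_mem_filW_zero hc,
    VShift_add n 1, fun a _ b _ hab => ?_, fun x hx => ?_⟩
  · exact hmem.2 ⟨0, mem_filW_zero.2 fun i => by simp, c, hc, (zero_add _).symm⟩
  · rw [← VShift_sub, mem_filW_zero] at hab
    have h := hab (Fin.last n)
    rw [coeff_VShift_last] at h
    exact mem_filW_zero.2 fun i => by rwa [Subsingleton.elim i 0]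
  · obtain ⟨b, hb, c, hc, rfl⟩ := hmem.1 hx
    exact ⟨c, hc, by rwa [add_sub_cancel_right]⟩
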